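/- Let a > 0, C > 0, and let g : ℝ → ℂ be a measurable function such that g(λ) = 0 for all λ < 0 and |g(λ)| ≤ C·e^{−aλ} for all λ ≥ 0. If ∫_ℝ λ^m · g(λ) dλ = 0 for every natural number m, then ∫_ℝ g(λ)·e^{−iξλ} dλ = 0 for every real ξ. -/

import Mathlib

open MeasureTheory Complex

theorem aux_bound_integrable (C b : ℝ) (hb : 0 < b) (m : ℕ) :
    Integrable ((Set.Ioi (0:ℝ)).indicator
      (fun l : ℝ => C * (l ^ m * Real.exp (-b * l)))) := by
  rw [integrable_indicator_iff measurableSet_Ioi]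
  have h := integrableOn_rpow_mul_exp_neg_mul_rpow (p := 1) (s := (m:ℝ)) (b := b)
    (by have : (0:ℝ) ≤ m := Nat.cast_nonneg m
        linarith) one_pos hb
  simp only [Real.rpow_natCast, Real.rpow_one] at h
  exact h.const_mul C

theorem aux_norm_le (a C : ℝ) (g : ℝ → ℂ)
    (hg_supp : ∀ l : ℝ, l < 0 → g l = 0)
    (hg_bound : ∀ l : ℝ, 0 ≤ l → ‖g l‖ ≤ C * Real.exp (-a * l))
    (m : ℕ) (r : ℝ) (z : ℂ) (hz : z.re ≤ r) (l : ℝ) (hl : l ≠ 0) :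
    ‖(l : ℂ) ^ m * g l * Complex.exp (z * l)‖ ≤
      (Set.Ioi (0:ℝ)).indicator (fun l : ℝ => C * (l ^ m * Real.exp (-(a - r) * l))) l := by
  rcases lt_or_gt_of_ne hl with h | h
  · rw [hg_supp l h, Set.indicator_of_notMem (by simp [h.le])]
    simp
  · rw [Set.indicator_of_mem (by exact h)]
    rw [norm_mul, norm_mul, norm_pow, Complex.norm_exp, Complex.norm_real, Real.norm_of_nonneg h.le]
    have h1 : Real.exp (z * l).re ≤ Real.exp (r * l) := by
      apply Real.exp_le_exp.2
      simp
      exact mul_le_mul_of_nonneg_right hz h.le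
    have h2 : Real.exp (-(a - r) * l) = Real.exp (-a * l) * Real.exp (r * l) := by
      rw [← Real.exp_add]; congr 1; ring
    have h3 := hg_bound l h.le
    have h4 : 0 ≤ C * Real.exp (-a * l) := (norm_nonneg _).trans h3
    calc l ^ m * ‖g l‖ * Real.exp (z * l).re
        ≤ l ^ m * (C * Real.exp (-a * l)) * Real.exp (r * l) := by gcongr
      _ = _ := by rw [h2]; ring

theorem aux_hasDerivAt (a C : ℝ) (g : ℝ → ℂ)
    (hg_meas : Measurable g)
    (hg_supp : ∀ l : ℝ, l < 0 → g l = 0)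
    (hg_bound : ∀ l : ℝ, 0 ≤ l → ‖g l‖ ≤ C * Real.exp (-a * l))
    (m : ℕ) (z : ℂ) (hz : z.re < a) :
    HasDerivAt (fun z : ℂ => ∫ l : ℝ, (l : ℂ) ^ m * g l * Complex.exp (z * l))
      (∫ l : ℝ, (l : ℂ) ^ (m + 1) * g l * Complex.exp (z * l)) z := by
  obtain ⟨r, hzr, hra⟩ := exists_between hz
  have hne : ∀ᵐ l : ℝ, l ≠ 0 := Measure.ae_ne volume 0
  have hm : ∀ (k : ℕ) (w : ℂ), AEStronglyMeasurable
      (fun l : ℝ => (l : ℂ) ^ k * g l * Complex.exp (w * l)) := by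
    intro k w
    apply Measurable.aestronglyMeasurable
    fun_prop
  have hs : {w : ℂ | w.re < r} ∈ nhds z :=
    (isOpen_lt Complex.continuous_re continuous_const).mem_nhds hzr
  refine (hasDerivAt_integral_of_dominated_loc_of_deriv_le
    (F := fun (z : ℂ) (l : ℝ) => (l : ℂ) ^ m * g l * Complex.exp (z * l))
    (F' := fun (z : ℂ) (l : ℝ) => (l : ℂ) ^ (m + 1) * g l * Complex.exp (z * l))
    hs (Filter.Eventually.of_forall fun w => hm m w) ?_ (hm (m+1) z) ?_
    (aux_bound_integrable C (a - r) (by linarith) (m + 1)) ?_).2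
  · refine (aux_bound_integrable C (a - r) (by linarith) m).mono' (hm m z) ?_
    filter_upwards [hne] with l hl
    exact aux_norm_le a C g hg_supp hg_bound m r z hzr.le l hl
  · filter_upwards [hne] with l hl w hw
    exact aux_norm_le a C g hg_supp hg_bound (m+1) r w (le_of_lt hw) l hl
  · refine Filter.Eventually.of_forall fun l w _ => ?_
    have h := (((hasDerivAt_id w).mul_const (l : ℂ)).cexp).const_mul ((l : ℂ) ^ m * g l)
    refine HasDerivAt.congr_deriv h ?_
    simp only [id]
    ring

/-- If all moments of an exponentially decaying measurable function supported on `[0,∞)`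
vanish, then its Fourier transform vanishes on the whole real line. -/
theorem fourier_vanishes_of_moments_vanish
    (a C : ℝ) (ha : 0 < a) (hC : 0 < C) (g : ℝ → ℂ)
    (hg_meas : Measurable g)
    (hg_supp : ∀ l : ℝ, l < 0 → g l = 0)
    (hg_bound : ∀ l : ℝ, 0 ≤ l → ‖g l‖ ≤ C * Real.exp (-a * l))
    (hmom : ∀ m : ℕ, ∫ l : ℝ, (l : ℂ) ^ m * g l = 0) :
    ∀ ξ : ℝ, ∫ l : ℝ, g l * Complex.exp (-Complex.I * ξ * l) = 0 := by
  intro ξ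
  set G : ℕ → ℂ → ℂ := fun m z => ∫ l : ℝ, (l : ℂ) ^ m * g l * Complex.exp (z * l) with hG
  have hd : ∀ m z, z.re < a → HasDerivAt (G m) (G (m+1) z) z := fun m z hz =>
    aux_hasDerivAt a C g hg_meas hg_supp hg_bound m z hz
  have hU : IsOpen {z : ℂ | z.re < a} := isOpen_lt Complex.continuous_re continuous_const
  have hit : ∀ m, ∀ z : ℂ, z.re < a → iteratedDeriv m (G 0) z = G m z := by
    intro m
    induction m with
    | zero => intro z _; simp
    | succ m ih =>
      intro z hz
      rw [iteratedDeriv_succ]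
      have : iteratedDeriv m (G 0) =ᶠ[nhds z] G m := by
        filter_upwards [hU.mem_nhds hz] with w hw using ih w hw
      rw [this.deriv_eq, (hd m z hz).deriv]
  have han : AnalyticOnNhd ℂ (G 0) {z : ℂ | z.re < a} :=
    DifferentiableOn.analyticOnNhd
      (fun z hz => (hd 0 z hz).differentiableAt.differentiableWithinAt) hU
  have h0 : (0 : ℂ) ∈ {z : ℂ | z.re < a} := by simpa using ha
  have hev : G 0 =ᶠ[nhds 0] 0 := by
    have hp := (han 0 h0).hasFPowerSeriesAt
    have hz : ∀ n, iteratedDeriv n (G 0) 0 = 0 := by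
      intro n
      rw [hit n 0 h0]
      simpa [hG] using hmom n
    have : (FormalMultilinearSeries.ofScalars ℂ
        (fun n => iteratedDeriv n (G 0) 0 / (n.factorial : ℂ))) = 0 := by
      ext n
      simp [hz, FormalMultilinearSeries.ofScalars]
    rw [this] at hp
    exact hp.eventually_eq_zero
  have hconv : IsPreconnected {z : ℂ | z.re < a} :=
    (convex_halfSpace_re_lt a).isPreconnected
  have := han.eqOn_zero_of_preconnected_of_eventuallyEq_zero hconv h0 hev
    (show (-Complex.I * ξ) ∈ {z : ℂ | z.re < a} by simpa using ha)
  simpa [hG] using this
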